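/- arXiv:0907.4311 — 3 statements merged into one kernel-verified Lean document; each statement's English description precedes it below -/
import Mathlib

section
/- Let r ≥ 1 be an integer and let s* be given by s*_i = 2^{−i} for 1 ≤ i < r and s*_r = 2^{−(r−1)}. Then F(s*) = ∑_{i=1}^{r−1} 1/(2^i − 1) + 2^{−(r−1)}, where F(s) = ∑_{i=1}^r s_i / max( ∑_{j=1}^i s_j , 1 − min_{1 ≤ j ≤ i} s_j ). Consequently, for every vector s of nonnegative reals with ∑_{i=1}^r s_i ≤ 1 one has F(s) ≤ ∑_{i=1}^{r−1} 1/(2^i − 1) + 2^{−(r−1)} ≤ λ, where λ = ∑_{i=1}^∞ 1/(2^i − 1). -/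
/-- The objective function of the mathematical program (MP_r) arising in the
worst-case analysis of the Subset Sum bin packing algorithm (0-based indices). -/
noncomputable def ssObj (r : ℕ) (s : Fin r → ℝ) : ℝ :=
  ∑ i : Fin r, s i /
    max (∑ j ∈ Finset.Iic i, s j)
        (1 - (Finset.Iic i).inf' ⟨i, Finset.mem_Iic.mpr le_rfl⟩ s)

/-- The optimal solution: `s*_i = 2^{-i}` for `1 ≤ i < r` and `s*_r = 2^{-(r-1)}`. -/
noncomputable def sStar (r : ℕ) : Fin r → ℝ := fun i =>
  if (i : ℕ) < r - 1 then (2 : ℝ) ^ (-((i : ℕ) : ℤ) - 1) else (2 : ℝ) ^ (-(r : ℤ) + 1)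

/-- The optimal value of (MP) with `n + 1` items when the remaining capacity is `R`. -/
noncomputable def ssValue : ℕ → ℝ → ℝ
  | 0, R => R
  | n + 1, R => R / (2 - R) + ssValue n (R / 2)

theorem ssValue_eq (n : ℕ) (R : ℝ) :
    ssValue n R = (∑ i ∈ Finset.range n, R / ((2 : ℝ) ^ (i + 1) - R)) + R / 2 ^ n := by
  induction n generalizing R with
  | zero => simp [ssValue]
  | succ n ih =>
    rw [ssValue, ih, Finset.sum_range_succ']
    have h : ∀ i : ℕ, R / 2 / ((2 : ℝ) ^ (i + 1) - R / 2) = R / (2 ^ (i + 1 + 1) - R) := by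
      intro i
      rw [div_div]
      congr 1
      ring
    simp only [h, zero_add, pow_one]
    rw [pow_succ, div_div, mul_comm (2 : ℝ) (2 ^ n)]
    ring

theorem div_two_sub_sub {x y : ℝ} (hx : x < 2) (hy : y < 2) :
    y / (2 - y) - x / (2 - x) = 2 * (y - x) / ((2 - x) * (2 - y)) := by
  have h1 : 2 - x ≠ 0 := by linarith
  have h2 : 2 - y ≠ 0 := by linarith
  field_simp
  ring

theorem sub_le_ssValue_sub (n : ℕ) {x y : ℝ} (hx : 0 ≤ x) (hxy : x ≤ y) (hy : y ≤ 1) :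
    y - x ≤ ssValue n y - ssValue n x := by
  induction n generalizing x y with
  | zero => simp [ssValue]
  | succ n ih =>
    have h := ih (x := x / 2) (y := y / 2) (by linarith) (by linarith) (by linarith)
    have h' : (y - x) / 2 ≤ y / (2 - y) - x / (2 - x) := by
      rw [div_two_sub_sub (by linarith) (by linarith), div_le_div_iff₀ (by norm_num) (by nlinarith)]
      have : (2 - x) * (2 - y) ≤ 4 := by nlinarith
      nlinarith
    simp only [ssValue]
    linarith

theorem ssValue_sub_le (n : ℕ) {x y : ℝ} (hxy : x ≤ y) (hyx : y ≤ 2 * x) (hy : y ≤ 1)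
    (hx : x ≤ 1 / 2) :
    ssValue n y - ssValue n x ≤ (y - x) / ((1 - x) * (1 - 2 * x + y)) := by
  have hpos : 0 < (1 - x) * (1 - 2 * x + y) := mul_pos (by linarith) (by linarith)
  induction n generalizing x y with
  | zero =>
    rw [le_div_iff₀ hpos]
    have : (1 - x) * (1 - 2 * x + y) ≤ 1 := by nlinarith
    simp only [ssValue]
    nlinarith
  | succ n ih =>
    have h := ih (x := x / 2) (y := y / 2) (by linarith) (by linarith) (by linarith)
      (by linarith) (mul_pos (by linarith) (by linarith))
    have h1 : 2 - x ≠ 0 := by linarith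
    have h2 : 2 - y ≠ 0 := by linarith
    have h3 : 2 - 2 * x + y ≠ 0 := by linarith
    have hsum : 2 * (y - x) / ((2 - x) * (2 - y))
        + (y / 2 - x / 2) / ((1 - x / 2) * (1 - 2 * (x / 2) + y / 2))
        = (y - x) / ((1 - y / 2) * (1 - x + y / 2)) := by
      have e1 : (1 - x / 2) * (1 - 2 * (x / 2) + y / 2) = (2 - x) * (2 - 2 * x + y) / 4 := by ring
      have e2 : (1 - y / 2) * (1 - x + y / 2) = (2 - y) * (2 - 2 * x + y) / 4 := by ring
      rw [e1, e2, div_add_div _ _ (mul_ne_zero h1 h2)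
        (div_ne_zero (mul_ne_zero h1 h3) four_ne_zero), div_eq_div_iff
        (mul_ne_zero (mul_ne_zero h1 h2) (div_ne_zero (mul_ne_zero h1 h3) four_ne_zero))
        (div_ne_zero (mul_ne_zero h2 h3) four_ne_zero)]
      ring
    have hle : (y - x) / ((1 - y / 2) * (1 - x + y / 2))
        ≤ (y - x) / ((1 - x) * (1 - 2 * x + y)) := by
      apply div_le_div_of_nonneg_left (by linarith) hpos
      have := mul_nonneg (show 0 ≤ 2 * x - y by linarith) (show 0 ≤ 1 - x + y / 4 by linarith)
      linarith
    have hd := div_two_sub_sub (x := x) (y := y) (by linarith) (by linarith)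
    simp only [ssValue]
    linarith

theorem div_max_le {R s : ℝ} (hs : 0 ≤ s) (hsR : s ≤ R) (hR : R ≤ 1) :
    s / max (1 - R + s) (1 - s) ≤ R := by
  have hpos : 0 < max (1 - R + s) (1 - s) := by
    rcases le_total s (1 / 2) with h | h
    · exact lt_max_of_lt_right (by linarith)
    · exact lt_max_of_lt_left (by linarith)
  rw [div_le_iff₀ hpos]
  have h1 := mul_le_mul_of_nonneg_left (le_max_left (1 - R + s) (1 - s)) (hs.trans hsR)
  nlinarith [mul_nonneg (sub_nonneg.2 hR) (sub_nonneg.2 hsR)]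

theorem div_max_add_ssValue_le (n : ℕ) {R s : ℝ} (hs : 0 ≤ s) (hsR : s ≤ R) (hR : R ≤ 1) :
    s / max (1 - R + s) (1 - s) + ssValue n (R - s) ≤ ssValue (n + 1) R := by
  rw [ssValue]
  have hR0 : 2 - R ≠ 0 := by linarith
  rcases le_total s (R / 2) with h | h
  · rw [max_eq_right (by linarith)]
    have h1 := ssValue_sub_le n (x := R / 2) (y := R - s) (by linarith) (by linarith)
      (by linarith) (by linarith)
    have hs1 : 1 - s ≠ 0 := by linarith
    have h2 : (R - s - R / 2) / ((1 - R / 2) * (1 - 2 * (R / 2) + (R - s)))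
        = R / (2 - R) - s / (1 - s) := by
      have e : (1 - R / 2) * (1 - 2 * (R / 2) + (R - s)) = (2 - R) * (1 - s) / 2 := by ring
      rw [e]
      field_simp
      ring
    linarith
  · rw [max_eq_left (by linarith)]
    have h1 := sub_le_ssValue_sub n (x := R - s) (y := R / 2) (by linarith) (by linarith)
      (by linarith)
    have hp : 0 < 1 - R + s := by linarith
    have h2 : s / (1 - R + s) - R / (2 - R)
        = (s - R / 2) * (1 - R) / ((1 - R + s) * (1 - R / 2)) := by
      have e : (1 - R + s) * (1 - R / 2) = (1 - R + s) * (2 - R) / 2 := by ring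
      rw [e]
      field_simp
      ring
    have h3 : (s - R / 2) * (1 - R) / ((1 - R + s) * (1 - R / 2)) ≤ s - R / 2 := by
      rw [div_le_iff₀ (mul_pos hp (by linarith))]
      apply mul_le_mul_of_nonneg_left _ (by linarith)
      nlinarith
    linarith

theorem sum_div_max_le_ssValue (n : ℕ) (a : ℕ → ℝ) (ha : ∀ i, 0 ≤ a i) (S : ℝ) (hS : 0 ≤ S)
    (hsum : S + ∑ i ∈ Finset.range (n + 1), a i ≤ 1) :
    ∑ i ∈ Finset.range (n + 1), a i / max (S + ∑ j ∈ Finset.range (i + 1), a j) (1 - a i)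
      ≤ ssValue n (1 - S) := by
  induction n generalizing a S with
  | zero =>
    simp only [zero_add, Finset.sum_range_one] at hsum ⊢
    simpa [ssValue] using div_max_le (R := 1 - S) (ha 0) (by linarith) (by linarith)
  | succ n ih =>
    rw [Finset.sum_range_succ'] at hsum ⊢
    have htail : 0 ≤ ∑ i ∈ Finset.range (n + 1), a (i + 1) :=
      Finset.sum_nonneg fun i _ => ha _
    have h1 := ih (fun i => a (i + 1)) (fun i => ha _) (S + a 0) (by linarith [ha 0])
      (by linarith)
    have h2 := div_max_add_ssValue_le n (R := 1 - S) (ha 0) (by linarith) (by linarith)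
    have h3 : ∀ i, S + ∑ j ∈ Finset.range (i + 1 + 1), a j
        = S + a 0 + ∑ j ∈ Finset.range (i + 1), a (j + 1) := by
      intro i
      rw [Finset.sum_range_succ']
      ring
    simp only [h3]
    simp only [zero_add, Finset.sum_range_one, sub_sub_cancel] at h2 ⊢
    rw [sub_sub] at h2
    linarith

theorem Fin.sum_Iic_eq_sum_range {r : ℕ} (a : ℕ → ℝ) (i : Fin r) :
    ∑ j ∈ Finset.Iic i, a j = ∑ j ∈ Finset.range (i + 1), a j := by
  have h : Finset.range ((i : ℕ) + 1) = (Finset.Iic i).map Fin.valEmbedding := by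
    rw [Fin.map_valEmbedding_Iic]
    ext j
    simp
  rw [h, Finset.sum_map]
  rfl

theorem ssObj_le_ssValue (n : ℕ) (s : Fin (n + 1) → ℝ) (hs : ∀ i, 0 ≤ s i)
    (hsum : ∑ i, s i ≤ 1) : ssObj (n + 1) s ≤ ssValue n 1 := by
  obtain ⟨a, ha, has⟩ : ∃ a : ℕ → ℝ, (∀ i, 0 ≤ a i) ∧ ∀ i : Fin (n + 1), s i = a i := by
    refine ⟨fun i => if h : i < n + 1 then s ⟨i, h⟩ else 0, fun i => ?_, fun i => by dsimp only; rw [dif_pos i.2]⟩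
    dsimp only
    split_ifs
    exacts [hs _, le_rfl]
  have hsum' : ∑ i ∈ Finset.range (n + 1), a i ≤ 1 := by
    rw [← Fin.sum_univ_eq_sum_range]
    simpa only [has] using hsum
  have hmain := sum_div_max_le_ssValue n a ha 0 le_rfl (by simpa using hsum')
  rw [sub_zero, ← Fin.sum_univ_eq_sum_range
    (fun i => a i / max (0 + ∑ j ∈ Finset.range (i + 1), a j) (1 - a i))] at hmain
  refine le_trans (Finset.sum_le_sum fun i _ => ?_) hmain
  have hS : ∑ j ∈ Finset.Iic i, s j = 0 + ∑ j ∈ Finset.range ((i : ℕ) + 1), a j := by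
    rw [zero_add, ← Fin.sum_Iic_eq_sum_range]
    exact Finset.sum_congr rfl fun j _ => has j
  have hmin : (Finset.Iic i).inf' ⟨i, Finset.mem_Iic.mpr le_rfl⟩ s ≤ a i := by
    rw [← has]
    exact Finset.inf'_le _ (Finset.mem_Iic.2 le_rfl)
  rw [hS, has i]
  refine div_le_div_of_nonneg_left (ha _) ?_ (max_le_max le_rfl (by linarith))
  rcases le_or_gt (a i) (1 / 2) with h | h
  · exact lt_max_of_lt_right (by linarith)
  · refine lt_max_of_lt_left ?_
    have := Finset.single_le_sum (fun j _ => ha j) (Finset.self_mem_range_succ (i : ℕ))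
    linarith

theorem sStar_castSucc (n : ℕ) (i : Fin n) : sStar (n + 1) i.castSucc = 1 / 2 ^ ((i : ℕ) + 1) := by
  rw [sStar, if_pos (by simp), one_div, ← zpow_natCast, ← zpow_neg]
  congr 1
  push_cast
  simp only [Fin.val_castSucc]
  ring

theorem sStar_last (n : ℕ) : sStar (n + 1) (Fin.last n) = 1 / 2 ^ n := by
  rw [sStar, if_neg (by simp), one_div, ← zpow_natCast, ← zpow_neg]
  congr 1
  push_cast
  ring

theorem antitone_sStar (n : ℕ) : Antitone (sStar (n + 1)) := by
  intro i j hij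
  induction j using Fin.lastCases with
  | last =>
    induction i using Fin.lastCases with
    | last => rfl
    | cast i =>
      rw [sStar_last, sStar_castSucc]
      exact one_div_pow_le_one_div_pow_of_le (by norm_num) i.2
  | cast j =>
    induction i using Fin.lastCases with
    | last => exact absurd hij (by simp)
    | cast i =>
      rw [sStar_castSucc, sStar_castSucc]
      exact one_div_pow_le_one_div_pow_of_le (by norm_num) (Nat.succ_le_succ hij)

theorem sum_range_one_div_two_pow_succ (m : ℕ) :
    ∑ j ∈ Finset.range m, 1 / (2 : ℝ) ^ (j + 1) = 1 - 1 / 2 ^ m := by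
  induction m with
  | zero => simp
  | succ m ih =>
    rw [Finset.sum_range_succ, ih, pow_succ]
    field_simp
    ring

theorem sum_Iic_sStar_castSucc (n : ℕ) (i : Fin n) :
    ∑ j ∈ Finset.Iic i.castSucc, sStar (n + 1) j = 1 - 1 / 2 ^ ((i : ℕ) + 1) := by
  rw [← sum_range_one_div_two_pow_succ]
  have h := Fin.sum_Iic_eq_sum_range (fun j => 1 / (2 : ℝ) ^ (j + 1)) i.castSucc
  rw [Fin.val_castSucc] at h
  rw [← h]
  refine Finset.sum_congr rfl fun j hj => ?_
  have hj' : (j : ℕ) < n := lt_of_le_of_lt (Fin.le_def.1 (Finset.mem_Iic.1 hj)) i.2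
  exact sStar_castSucc n ⟨j, hj'⟩

theorem sum_Iic_sStar_last (n : ℕ) :
    ∑ j ∈ Finset.Iic (Fin.last n), sStar (n + 1) j = 1 := by
  have h : Finset.Iic (Fin.last n) = Finset.univ := by
    ext j
    simp [Fin.le_last]
  rw [h, Fin.sum_univ_castSucc, sStar_last]
  simp only [sStar_castSucc]
  rw [Fin.sum_univ_eq_sum_range (fun j => 1 / (2 : ℝ) ^ (j + 1)), sum_range_one_div_two_pow_succ]
  ring

theorem inf'_Iic_eq_of_antitone {r : ℕ} {s : Fin r → ℝ} (hs : Antitone s) (i : Fin r) :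
    (Finset.Iic i).inf' ⟨i, Finset.mem_Iic.mpr le_rfl⟩ s = s i :=
  le_antisymm (Finset.inf'_le _ (Finset.mem_Iic.2 le_rfl))
    (Finset.le_inf' _ _ fun _ hj => hs (Finset.mem_Iic.1 hj))

theorem ssObj_sStar (n : ℕ) : ssObj (n + 1) (sStar (n + 1)) = ssValue n 1 := by
  rw [ssObj, ssValue_eq, Fin.sum_univ_castSucc]
  simp only [inf'_Iic_eq_of_antitone (antitone_sStar n), sum_Iic_sStar_castSucc,
    sum_Iic_sStar_last, sStar_castSucc, sStar_last, max_self]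
  rw [max_eq_left (sub_le_self _ (by positivity)), div_one,
    Fin.sum_univ_eq_sum_range (fun i => 1 / (2 : ℝ) ^ (i + 1) / (1 - 1 / 2 ^ (i + 1)))]
  congr 1
  refine Finset.sum_congr rfl fun i _ => ?_
  rw [div_div, mul_sub, mul_one, mul_one_div_cancel (by positivity)]

theorem ssValue_one_le_tsum (n : ℕ) : ssValue n 1 ≤ ∑' i : ℕ, 1 / ((2 : ℝ) ^ (i + 1) - 1) := by
  have hpow : ∀ i : ℕ, (2 : ℝ) ^ i ≤ 2 ^ (i + 1) - 1 := by
    intro i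
    have := one_le_pow₀ (n := i) (one_le_two (α := ℝ))
    rw [pow_succ]
    linarith
  have hpos : ∀ i : ℕ, 0 < (2 : ℝ) ^ (i + 1) - 1 := fun i => lt_of_lt_of_le (by positivity) (hpow i)
  have hf : Summable fun i : ℕ => 1 / ((2 : ℝ) ^ (i + 1) - 1) := by
    refine Summable.of_nonneg_of_le (fun i => (one_div_pos.2 (hpos i)).le) (fun i => ?_)
      summable_geometric_two
    rw [one_div_pow]
    exact one_div_le_one_div_of_le (by positivity) (hpow i)
  have hg := hasSum_geometric_two' ((1 : ℝ) / 2 ^ n)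
  rw [ssValue_eq, ← hf.sum_add_tsum_nat_add n, ← hg.tsum_eq]
  refine add_le_add_right ?_ _
  refine hg.summable.tsum_le_tsum (fun i => ?_) ((summable_nat_add_iff n).2 hf)
  rw [div_div, div_div]
  refine one_div_le_one_div_of_le (hpos _) ?_
  rw [pow_succ, pow_add]
  linarith

/-- The value of (MP_r) is `λ_r = ∑_{i=1}^{r-1} 1/(2^i - 1) + 2^{-(r-1)}`, every
feasible solution has value at most `λ_r`, and `λ_r ≤ λ = ∑_{i=1}^∞ 1/(2^i - 1)`. -/
theorem ssObj_sStar_value (r : ℕ) (hr : 1 ≤ r) :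
    ssObj r (sStar r)
      = (∑ i ∈ Finset.range (r - 1), 1 / ((2 : ℝ) ^ (i + 1) - 1)) + (2 : ℝ) ^ (-(r : ℤ) + 1)
    ∧ (∀ s : Fin r → ℝ, (∀ i, 0 ≤ s i) → ∑ i, s i ≤ 1 →
        ssObj r s
          ≤ (∑ i ∈ Finset.range (r - 1), 1 / ((2 : ℝ) ^ (i + 1) - 1)) + (2 : ℝ) ^ (-(r : ℤ) + 1))
    ∧ (∑ i ∈ Finset.range (r - 1), 1 / ((2 : ℝ) ^ (i + 1) - 1)) + (2 : ℝ) ^ (-(r : ℤ) + 1)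
        ≤ ∑' i : ℕ, 1 / ((2 : ℝ) ^ (i + 1) - 1) := by
  obtain ⟨n, rfl⟩ : ∃ n, r = n + 1 := ⟨r - 1, by omega⟩
  have hpow : (2 : ℝ) ^ (-((n + 1 : ℕ) : ℤ) + 1) = 1 / 2 ^ n := by
    rw [one_div, ← zpow_natCast, ← zpow_neg]
    congr 1
    push_cast
    ring
  rw [Nat.add_sub_cancel, hpow, ← ssValue_eq n 1]
  exact ⟨ssObj_sStar n, ssObj_le_ssValue n, ssValue_one_le_tsum n⟩
end

section
/- Let t ≥ 2 be an integer and let I be a finite list of items, each with a real size in (0, 1/t]. Let B_1, …, B_m be a subset-sum (SS) packing of I and let O_1, …, O_n be any packing of I. Then m ≤ λ^t·n + 1, where λ^t = 1 + ∑_{i=1}^∞ 1/( (t+1)·2^i − 1 ). -/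
/-- The load of bin `k` in the assignment `f` of items to `m` bins. -/
noncomputable def binLoad {ι : Type*} [Fintype ι] (size : ι → ℝ) {m : ℕ}
    (f : ι → Fin m) (k : Fin m) : ℝ :=
  ∑ i ∈ Finset.univ.filter (fun i => f i = k), size i

/-- `f` is a packing of the items into `m` (nonempty) bins. -/
def IsPacking {ι : Type*} [Fintype ι] (size : ι → ℝ) (m : ℕ) (f : ι → Fin m) : Prop :=
  Function.Surjective f ∧ ∀ k : Fin m, binLoad size f k ≤ 1

/-- `f` is a subset-sum (SS) packing. -/
def IsSSPacking {ι : Type*} [Fintype ι] (size : ι → ℝ) (m : ℕ) (f : ι → Fin m) : Prop :=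
  IsPacking size m f ∧
    ∀ k : Fin m, ∀ S : Finset ι, (∀ i ∈ S, k ≤ f i) → ∑ i ∈ S, size i ≤ 1 →
      ∑ i ∈ S, size i ≤ binLoad size f k

open Finset

/-- The excess `∑_{i ≥ 1} y / (2^i - y)` over `1` of the worst-case ratio, as a function of the
space `y` left over by the large items. -/
noncomputable def halvingSum (y : ℝ) : ℝ := ∑' i : ℕ, y / (2 ^ (i + 1) - y)

lemma two_le_two_pow_succ (i : ℕ) : (2 : ℝ) ≤ 2 ^ (i + 1) := by
  have : (1 : ℝ) ≤ 2 ^ i := one_le_pow₀ (by norm_num)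
  rw [pow_succ]; linarith

lemma summable_halvingSum {y : ℝ} (h0 : 0 ≤ y) (h1 : y ≤ 1) :
    Summable fun i : ℕ => y / (2 ^ (i + 1) - y) := by
  refine Summable.of_nonneg_of_le (fun i => ?_) (fun i => ?_) summable_geometric_two
  · have := two_le_two_pow_succ i
    exact div_nonneg h0 (by linarith)
  · have h2 : (1 : ℝ) ≤ 2 ^ i := one_le_pow₀ (by norm_num)
    rw [one_div, inv_pow, ← one_div, div_le_div_iff₀ (by rw [pow_succ]; linarith) (by positivity),
      pow_succ]
    nlinarith

lemma halvingSum_nonneg {y : ℝ} (h0 : 0 ≤ y) (h1 : y ≤ 1) : 0 ≤ halvingSum y :=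
  tsum_nonneg fun i => div_nonneg h0 (by linarith [two_le_two_pow_succ i])

lemma halvingSum_two_mul {x : ℝ} (h0 : 0 ≤ x) (h1 : x ≤ 1 / 2) :
    halvingSum (2 * x) = x / (1 - x) + halvingSum x := by
  have hs := summable_halvingSum (y := 2 * x) (by linarith) (by linarith)
  unfold halvingSum
  rw [hs.tsum_eq_zero_add]
  congr 1
  · rw [zero_add, pow_one, ← mul_one_sub, mul_div_mul_left _ _ two_ne_zero]
  · refine tsum_congr fun i => ?_
    rw [pow_succ _ (i + 1), mul_comm _ (2 : ℝ), ← mul_sub, mul_div_mul_left _ _ two_ne_zero]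

lemma sub_le_halvingSum_sub {y z : ℝ} (h0 : 0 ≤ y) (hyz : y ≤ z) (h1 : z ≤ 1) :
    z - y ≤ halvingSum z - halvingSum y := by
  unfold halvingSum
  rw [← (summable_halvingSum (h0.trans hyz) h1).tsum_sub (summable_halvingSum h0 (hyz.trans h1)),
    ← tsum_geometric_two' (z - y)]
  refine (summable_geometric_two' (z - y)).tsum_le_tsum (fun i => ?_)
    ((summable_halvingSum (h0.trans hyz) h1).sub (summable_halvingSum h0 (hyz.trans h1)))
  have hc := two_le_two_pow_succ i
  have e : (z - y) / 2 / 2 ^ i = (z - y) / 2 ^ (i + 1) := by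
    rw [pow_succ, div_div, mul_comm]
  rw [e]
  generalize (2 : ℝ) ^ (i + 1) = c at hc
  have hz : 0 < c - z := by linarith
  have hy : 0 < c - y := by linarith
  have : z / (c - z) - y / (c - y) = c * (z - y) / ((c - z) * (c - y)) := by
    field_simp; ring
  rw [this, div_le_div_iff₀ (by linarith) (by positivity)]
  have : (c - z) * (c - y) ≤ c * c := by
    apply mul_le_mul <;> linarith
  nlinarith [mul_le_mul_of_nonneg_left this (sub_nonneg.2 hyz)]

lemma halvingSum_le_chord {x y : ℝ} (h0 : 0 < x) (h1 : x ≤ 1 / 2) (hxy : x ≤ y)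
    (hy : y ≤ 2 * x) : halvingSum y ≤ halvingSum x + (y - x) / (1 - x) := by
  have sx := summable_halvingSum h0.le (by linarith)
  have s2x := summable_halvingSum (y := 2 * x) (by linarith) (by linarith)
  have sy := summable_halvingSum (y := y) (by linarith) (by linarith)
  have key : halvingSum y ≤
      halvingSum x + (y - x) / x * (halvingSum (2 * x) - halvingSum x) := by
    unfold halvingSum
    rw [← s2x.tsum_sub sx, ← tsum_mul_left, ← sx.tsum_add ((s2x.sub sx).mul_left _)]
    refine sy.tsum_le_tsum (fun i => ?_) (sx.add ((s2x.sub sx).mul_left _))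
    have hc := two_le_two_pow_succ i
    generalize (2 : ℝ) ^ (i + 1) = c at hc
    have hx' : 0 < c - x := by linarith
    have hy' : 0 < c - y := by linarith
    have h2 : 0 < c - 2 * x := by linarith
    have e1 : y / (c - y) = x / (c - x) + c * (y - x) / ((c - y) * (c - x)) := by
      field_simp; ring
    have e2 : 2 * x / (c - 2 * x) - x / (c - x) = c * x / ((c - 2 * x) * (c - x)) := by
      rw [div_sub_div _ _ h2.ne' hx'.ne']
      ring
    have e3 : (y - x) / x * (c * x / ((c - 2 * x) * (c - x))) =
        c * (y - x) / ((c - 2 * x) * (c - x)) := by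
      rw [div_mul_div_comm, show (y - x) * (c * x) = x * (c * (y - x)) by ring,
        mul_div_mul_left _ _ h0.ne']
    rw [e1, e2, e3]
    gcongr
  rw [halvingSum_two_mul h0.le h1] at key
  have : (y - x) / x * (x / (1 - x) + halvingSum x - halvingSum x) = (y - x) / (1 - x) := by
    rw [add_sub_cancel_right, div_mul_div_cancel₀ h0.ne']
  linarith

/-- The weight gathered by filling the space `r` down to `y` at density `1 / (1 - y)` and then
halving the space `y` forever. -/
noncomputable def fillThenHalve (r y : ℝ) : ℝ := (r - y) / (1 - y) + halvingSum y

lemma fillThenHalve_mono {r y z : ℝ} (hr : r ≤ 1) (h0 : 0 ≤ y) (hyz : y ≤ z) (hz : z ≤ r / 2) :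
    fillThenHalve r y ≤ fillThenHalve r z := by
  have hs := sub_le_halvingSum_sub h0 hyz (by linarith)
  have hz' : 0 < 1 - z := by linarith
  have hy' : 0 < 1 - y := by linarith
  have e : (r - y) / (1 - y) - (r - z) / (1 - z) =
      (z - y) * (1 - r) / ((1 - y) * (1 - z)) := by
    field_simp; ring
  have : (z - y) * (1 - r) / ((1 - y) * (1 - z)) ≤ z - y := by
    rw [div_le_iff₀ (by positivity)]
    refine mul_le_mul_of_nonneg_left ?_ (by linarith)
    nlinarith
  unfold fillThenHalve
  linarith

lemma fillThenHalve_half {r : ℝ} (h0 : 0 ≤ r) (h1 : r ≤ 1) :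
    fillThenHalve r (r / 2) = halvingSum r := by
  have := halvingSum_two_mul (x := r / 2) (by linarith) (by linarith)
  rw [mul_div_cancel₀ r two_ne_zero] at this
  rw [this, fillThenHalve, sub_half]

/-- A bound on the weight that can still be gathered in a bin with remaining space `r`, when the
density is at most `1 / (1 - u)`. -/
noncomputable def potential (r u : ℝ) : ℝ := fillThenHalve r (min u (r / 2))

lemma potential_nonneg {r u : ℝ} (h0 : 0 ≤ r) (h1 : r ≤ 1) (hu : 0 ≤ u) : 0 ≤ potential r u := by
  have hv : 0 ≤ min u (r / 2) := le_min hu (by linarith)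
  have hv' : min u (r / 2) ≤ r / 2 := min_le_right _ _
  exact add_nonneg (div_nonneg (by linarith) (by linarith))
    (halvingSum_nonneg hv (by linarith))

lemma potential_le_fillThenHalve {r v : ℝ} (h1 : r ≤ 1) (h0 : 0 < v)
    (hv : v ≤ 1 / 2) (hvr : v ≤ r) : potential r v ≤ fillThenHalve r v := by
  unfold potential
  rcases le_total v (r / 2) with h | h
  · rw [min_eq_left h]
  · rw [min_eq_right h, fillThenHalve_half (by linarith) h1, fillThenHalve, add_comm]
    exact halvingSum_le_chord h0 hv hvr (by linarith)

lemma potential_step {r u x d : ℝ} (hr : r ≤ 1) (hu0 : 0 < u) (hu : u ≤ 1 / 2) (hx0 : 0 < x)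
    (hx : x ≤ r) (hd : 1 - min u x ≤ d) (hd' : 1 - (r - x) ≤ d) :
    x / d + potential (r - x) (min u x) ≤ potential r u := by
  have hv0 : 0 < min u x := lt_min hu0 hx0
  have hvu : min u x ≤ u := min_le_left _ _
  have hvx : min u x ≤ x := min_le_right _ _
  rcases le_total (min u x) (r - x) with h | h
  · have h1 := potential_le_fillThenHalve (by linarith) hv0 (hvu.trans hu) h
    have h2 : fillThenHalve r (min u x) ≤ potential r u :=
      fillThenHalve_mono hr hv0.le (le_min hvu (by linarith)) (min_le_right _ _)
    have h3 : x / d ≤ x / (1 - min u x) := by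
      gcongr
      linarith
    have h4 : x / (1 - min u x) + fillThenHalve (r - x) (min u x) =
        fillThenHalve r (min u x) := by
      rw [fillThenHalve, fillThenHalve, ← add_assoc, ← add_div]
      congr 2
      ring
    linarith
  · have h1 : potential (r - x) (min u x) = halvingSum (r - x) := by
      rw [potential, min_eq_right (by linarith), fillThenHalve_half (by linarith) (by linarith)]
    have h2 : fillThenHalve r (r - x) ≤ potential r u :=
      fillThenHalve_mono hr (by linarith) (le_min (by linarith) (by linarith)) (min_le_right _ _)
    have h3 : x / d ≤ x / (1 - (r - x)) := by
      gcongr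
      linarith
    have h4 : fillThenHalve r (r - x) = x / (1 - (r - x)) + halvingSum (r - x) := by
      rw [fillThenHalve, sub_sub_cancel]
    linarith

section Packing

variable {ι : Type*} [Fintype ι] {size : ι → ℝ} {m : ℕ} {f : ι → Fin m}

lemma size_le_binLoad (hpos : ∀ i, 0 < size i) (i : ι) : size i ≤ binLoad size f (f i) :=
  single_le_sum (f := size) (fun j _ => (hpos j).le) (by simp)

lemma one_lt_binLoad_add_size (hpos : ∀ i, 0 < size i) (hf : IsSSPacking size m f) {k : Fin m}
    {i : ι} (h : k < f i) : 1 < binLoad size f k + size i := by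
  classical
  by_contra! hle
  have hi : i ∉ univ.filter (fun j => f j = k) := by simp [h.ne']
  have hs : ∑ j ∈ insert i (univ.filter fun j => f j = k), size j =
      size i + binLoad size f k := by
    rw [sum_insert hi]; rfl
  have := hf.2 k (insert i (univ.filter fun j => f j = k))
    (by
      intro j hj
      rcases mem_insert.1 hj with rfl | hj
      · exact h.le
      · exact (by simpa using hj : f j = k).ge)
    (by rw [hs]; linarith)
  rw [hs] at this
  linarith [hpos i]

lemma binLoad_antitone (hf : IsSSPacking size m f) : Antitone (binLoad size f) := by
  intro k l hkl
  refine hf.2 k (univ.filter fun j => f j = l) (fun j hj => ?_) (hf.1.2 l)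
  rwa [(by simpa using hj : f j = l)]

/-- All SS bins except possibly the last two have load at least `t / (t + 1)`. -/
lemma le_binLoad_of_succ_succ_lt {t : ℕ} (ht : 0 < t)
    (hsize : ∀ i, size i ∈ Set.Ioc (0 : ℝ) (1 / (t : ℝ)))
    (hf : IsSSPacking size m f) {k : ℕ} (hk : k + 2 < m) :
    1 - 1 / ((t : ℝ) + 1) ≤ binLoad size f ⟨k, by omega⟩ := by
  classical
  by_contra! hlt
  have hpos : ∀ i, 0 < size i := fun i => (hsize i).1
  have ht' : (0 : ℝ) < t := by exact_mod_cast ht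
  have hbig : ∀ i, (⟨k, by omega⟩ : Fin m) < f i → 1 / ((t : ℝ) + 1) < size i := fun i hi => by
    linarith [one_lt_binLoad_add_size hpos hf hi]
  have hsum : ∀ T : Finset ι, T.card ≤ t → ∑ i ∈ T, size i ≤ 1 := fun T hT => by
    calc ∑ i ∈ T, size i ≤ T.card • (1 / (t : ℝ)) := sum_le_card_nsmul _ _ _ fun i _ => (hsize i).2
      _ = T.card / t := by rw [nsmul_eq_mul, mul_one_div]
      _ ≤ 1 := by rw [div_le_one ht']; exact_mod_cast hT
  set U : Finset ι := univ.filter fun i => (⟨k, by omega⟩ : Fin m) < f i with hU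
  rcases le_or_gt t U.card with hc | hc
  · obtain ⟨T, hTU, hT⟩ := exists_subset_card_eq hc
    have hTU' : ∀ i ∈ T, (⟨k, by omega⟩ : Fin m) < f i := fun i hi => by
      simpa [hU] using hTU hi
    have h1 := hf.2 ⟨k, by omega⟩ T (fun i hi => (hTU' i hi).le) (hsum T hT.le)
    have h2 : T.card • (1 / ((t : ℝ) + 1)) ≤ ∑ i ∈ T, size i :=
      card_nsmul_le_sum _ _ _ fun i hi => (hbig i (hTU' i hi)).le
    rw [hT, nsmul_eq_mul] at h2
    have : (t : ℝ) * (1 / ((t : ℝ) + 1)) = 1 - 1 / ((t : ℝ) + 1) := by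
      field_simp; ring
    linarith
  · have h1 := hf.2 ⟨k + 1, by omega⟩ U
      (fun i hi => by
        have : (⟨k, by omega⟩ : Fin m) < f i := by simpa [hU] using hi
        rw [Fin.lt_def] at this
        rw [Fin.le_def]
        exact this)
      (hsum U hc.le)
    obtain ⟨j, hj⟩ := hf.1.1 ⟨k + 2, hk⟩
    have hjU : j ∈ U := by simp [hU, hj]
    have hjn : j ∉ univ.filter (fun i => f i = ⟨k + 1, by omega⟩) := by simp [hj]
    have h2 : ∑ i ∈ insert j (univ.filter fun i => f i = ⟨k + 1, by omega⟩), size i ≤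
        ∑ i ∈ U, size i := by
      refine sum_le_sum_of_subset_of_nonneg (fun i hi => ?_) fun i _ _ => (hpos i).le
      rcases mem_insert.1 hi with rfl | hi
      · exact hjU
      · have hi' : f i = ⟨k + 1, by omega⟩ := by simpa using hi
        simp [hU, hi']
    rw [sum_insert hjn] at h2
    change size j + binLoad size f ⟨k + 1, by omega⟩ ≤ _ at h2
    linarith [hpos j]

/-- The weight of an item: its share of its SS bin, capped by the density `1 / (1 - size i)`
and by the density `1 / (1 - ρ)`. -/
noncomputable def itemWeight (size : ι → ℝ) (f : ι → Fin m) (ρ : ℝ) (i : ι) : ℝ :=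
  size i / max (binLoad size f (f i)) (max (1 - size i) (1 - ρ))

/-- Any set of items that fits into one bin has weight at most `1 + halvingSum ρ`. -/
lemma sum_itemWeight_le (hpos : ∀ i, 0 < size i) (hf : IsSSPacking size m f) {ρ : ℝ}
    (hρ0 : 0 < ρ) (hρ : ρ ≤ 1 / 2) (s : Finset ι) (hs : ∑ i ∈ s, size i ≤ 1) :
    ∑ i ∈ s, itemWeight size f ρ i ≤ 1 + halvingSum ρ := by
  classical
  have key : ∑ i ∈ s, size i ≤ 1 → ∃ u, 0 < u ∧ u ≤ 1 / 2 ∧ (u = ρ ∨ ∃ l ∈ s, u = size l) ∧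
      ∑ i ∈ s, itemWeight size f ρ i + potential (1 - ∑ i ∈ s, size i) u ≤ potential 1 ρ := by
    induction s using Finset.induction_on_max_value
      (fun i => toLex (OrderDual.toDual (f i), OrderDual.toDual (size i))) with
    | empty => exact fun _ => ⟨ρ, hρ0, hρ, Or.inl rfl, by simp⟩
    | insert a s ha hmax ih =>
      intro hsum
      rw [sum_insert ha] at hsum
      obtain ⟨u, hu0, hu, hmem, hle⟩ := ih (by linarith [hpos a]) (by linarith [hpos a])
      have hmax' : ∀ l ∈ s, f a < f l ∨ f a = f l ∧ size a ≤ size l := fun l hl => by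
        have := hmax l hl
        rw [Prod.Lex.toLex_le_toLex] at this
        simpa [eq_comm] using this
      set d := max (binLoad size f (f a)) (max (1 - size a) (1 - ρ)) with hd
      have hd1 : binLoad size f (f a) ≤ d := le_max_left _ _
      have hd2 : 1 - size a ≤ d := (le_max_left _ _).trans (le_max_right _ _)
      have hd3 : 1 - ρ ≤ d := (le_max_right _ _).trans (le_max_right _ _)
      have hdu : 1 - u ≤ d := by
        rcases hmem with rfl | ⟨l, hl, rfl⟩
        · exact hd3
        · rcases hmax' l hl with h | h
          · linarith [one_lt_binLoad_add_size hpos hf h]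
          · linarith
      have hload := hf.2 (f a) (insert a s)
        (fun i hi => by
          rcases mem_insert.1 hi with rfl | hi
          · exact le_rfl
          · rcases hmax' i hi with h | h
            · exact h.le
            · exact h.1.le)
        (by rw [sum_insert ha]; exact hsum)
      rw [sum_insert ha] at hload
      have hstep := potential_step (r := 1 - ∑ i ∈ s, size i) (u := u) (x := size a) (d := d)
        (by linarith [sum_nonneg fun i (_ : i ∈ s) => (hpos i).le]) hu0 hu (hpos a)
        (by linarith) (by rcases min_choice u (size a) with h | h <;> rw [h] <;> assumption)
        (by linarith)
      refine ⟨min u (size a), lt_min hu0 (hpos a), (min_le_left _ _).trans hu, ?_, ?_⟩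
      · rcases min_choice u (size a) with h | h <;> rw [h]
        · rcases hmem with h | ⟨l, hl, h⟩
          · exact Or.inl h
          · exact Or.inr ⟨l, mem_insert_of_mem hl, h⟩
        · exact Or.inr ⟨a, mem_insert_self _ _, rfl⟩
      · rw [sum_insert ha, sum_insert ha]
        have e : 1 - (size a + ∑ i ∈ s, size i) = 1 - ∑ i ∈ s, size i - size a := by ring
        have ew : itemWeight size f ρ a = size a / d := rfl
        rw [e, ew]
        linarith
  obtain ⟨u, hu0, -, -, hle⟩ := key hs
  have h0 := potential_nonneg (r := 1 - ∑ i ∈ s, size i) (u := u) (by linarith)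
    (by linarith [sum_nonneg fun i (_ : i ∈ s) => (hpos i).le]) hu0.le
  have h1 : potential 1 ρ = 1 + halvingSum ρ := by
    rw [potential, min_eq_left hρ, fillThenHalve, div_self (by linarith)]
  linarith

/-- The total load ratio of consecutive bins, with denominators truncated below at `τ`, is at
least the number of bins minus one. -/
lemma le_sum_of_load_ratio {D W : ℕ → ℝ} {τ : ℝ} (hτ : 0 < τ) (hD0 : D 0 = 1) {m : ℕ}
    (hanti : ∀ k < m, D (k + 1) ≤ D k) (hle : ∀ k ≤ m, D k ≤ 1)
    (hpair : ∀ k < m, 1 ≤ D k + D (k + 1)) (hτD : ∀ k, k + 2 ≤ m → τ ≤ D k)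
    (hW : ∀ k < m, D (k + 1) / max (D k) τ ≤ W k) :
    (m : ℝ) - 1 ≤ ∑ k ∈ range m, W k := by
  have key : ∀ k, k + 1 ≤ m →
      (k : ℝ) - (1 - D k) / max (D k) τ ≤ ∑ j ∈ range k, W j := by
    intro k
    induction k with
    | zero => intro _; simp [hD0]
    | succ k ih =>
      intro hk
      have h1 := ih (by omega)
      have h2 := hW k (by omega)
      have h3 := hτD k (by omega)
      have h4 := hanti k (by omega)
      have h5 := hle (k + 1) (by omega)
      rw [max_eq_left h3] at h1 h2
      have hDk : 0 < D k := hτ.trans_le h3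
      have h6 : (1 - D (k + 1)) / D k ≤ (1 - D (k + 1)) / max (D (k + 1)) τ :=
        div_le_div_of_nonneg_left (by linarith) (lt_max_of_lt_right hτ) (max_le h4 h3)
      have h7 : (1 - D (k + 1)) / D k = (1 - D k) / D k + 1 - D (k + 1) / D k := by
        field_simp; ring
      rw [sum_range_succ]
      push_cast
      linarith
  rcases m with _ | k
  · simp
  · have h1 := key k le_rfl
    have h2 := hW k (by omega)
    have h3 := hpair k (by omega)
    have h4 : (1 - D k) / max (D k) τ ≤ D (k + 1) / max (D k) τ := by
      have : 0 < max (D k) τ := lt_max_of_lt_right hτ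
      gcongr
      linarith
    rw [sum_range_succ]
    push_cast
    linarith

lemma sub_one_le_sum_itemWeight {t : ℕ} (ht : 0 < t)
    (hsize : ∀ i, size i ∈ Set.Ioc (0 : ℝ) (1 / (t : ℝ))) (hf : IsSSPacking size m f) :
    (m : ℝ) - 1 ≤ ∑ i, itemWeight size f (1 / ((t : ℝ) + 1)) i := by
  classical
  have hpos : ∀ i, 0 < size i := fun i => (hsize i).1
  have ht' : (0 : ℝ) < t := by exact_mod_cast ht
  set ρ : ℝ := 1 / ((t : ℝ) + 1) with hρ
  have hρ1 : ρ < 1 := by rw [hρ, div_lt_one] <;> linarith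
  have hρ0 : 0 < ρ := by positivity
  have hload0 : ∀ k, 0 ≤ binLoad size f k := fun k => sum_nonneg fun i _ => (hpos i).le
  let D : ℕ → ℝ := fun k =>
    k.casesOn 1 fun j => if h : j < m then binLoad size f ⟨j, h⟩ else 0
  let W : ℕ → ℝ := fun k =>
    if h : k < m then ∑ i with f i = ⟨k, h⟩, itemWeight size f ρ i else 0
  have hD : ∀ k (h : k < m), D (k + 1) = binLoad size f ⟨k, h⟩ := fun k h => dif_pos h
  have hWk : ∀ k (h : k < m), W k = ∑ i with f i = ⟨k, h⟩, itemWeight size f ρ i :=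
    fun k h => dif_pos h
  have hsumW : ∑ i, itemWeight size f ρ i = ∑ k ∈ range m, W k := by
    rw [← sum_fiberwise univ f, sum_range]
    exact sum_congr rfl fun k _ => (hWk k k.2).symm
  have hle : ∀ k ≤ m, D k ≤ 1 := by
    rintro (_ | k) hk
    · exact le_rfl
    · rw [hD k hk]
      exact hf.1.2 _
  have hanti : ∀ k < m, D (k + 1) ≤ D k := by
    rintro (_ | k) hk
    · exact hle 1 hk
    · rw [hD _ hk, hD k (by omega)]
      exact binLoad_antitone hf (Fin.le_def.2 (by simp))
  have hnext : ∀ k (hk : k < m) (i : ι), f i = ⟨k, hk⟩ → 1 - size i ≤ D k := by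
    rintro (_ | k) hk i hi
    · exact sub_le_self _ (hpos i).le
    · rw [hD k (by omega)]
      have := one_lt_binLoad_add_size hpos hf (k := ⟨k, by omega⟩) (i := i)
        (by rw [hi, Fin.lt_def]; simp)
      linarith
  rw [hsumW]
  refine le_sum_of_load_ratio (τ := 1 - ρ) (by linarith) rfl hanti hle
    (fun k hk => ?_) ?_ fun k hk => ?_
  · obtain ⟨i, hi⟩ := hf.1.1 ⟨k, hk⟩
    have h1 := hnext k hk i hi
    have h2 := size_le_binLoad (f := f) hpos i
    rw [hi, ← hD k hk] at h2
    linarith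
  · rintro (_ | k) hk
    · exact sub_le_self _ hρ0.le
    · rw [hD k (by omega)]
      exact le_binLoad_of_succ_succ_lt ht hsize hf (by omega)
  · rw [hWk k hk, hD k hk, binLoad, sum_div]
    refine sum_le_sum fun i hi => ?_
    have hi' : f i = ⟨k, hk⟩ := by simpa using hi
    refine div_le_div_of_nonneg_left (hpos i).le
      (lt_max_of_lt_right (lt_max_of_lt_right (by linarith))) (max_le ?_ (max_le ?_ ?_))
    · rw [hi', ← hD k hk]
      exact (hanti k hk).trans (le_max_left _ _)
    · exact (hnext k hk i hi').trans (le_max_left _ _)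
    · exact le_max_right _ _

end Packing

/-- Parametric upper bound for the Subset Sum algorithm: for item sizes in
`(0, 1/t]`, if `f` is an SS packing into `m` bins and `g` is any packing into
`n` bins, then `m ≤ λ^t·n + 1` where `λ^t = 1 + ∑_{i=1}^∞ 1/((t+1)·2^i - 1)`. -/
theorem ssPacking_parametric_le (t : ℕ) (ht : 2 ≤ t) {ι : Type*} [Fintype ι]
    (size : ι → ℝ) (hsize : ∀ i, size i ∈ Set.Ioc (0 : ℝ) (1 / (t : ℝ))) {m n : ℕ}
    (f : ι → Fin m) (g : ι → Fin n)
    (hf : IsSSPacking size m f) (hg : IsPacking size n g) :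
    (m : ℝ) ≤ (1 + ∑' i : ℕ, 1 / (((t : ℝ) + 1) * 2 ^ (i + 1) - 1)) * n + 1 := by
  classical
  have ht' : (2 : ℝ) ≤ t := by exact_mod_cast ht
  have hpos : ∀ i, 0 < size i := fun i => (hsize i).1
  have hlower := sub_one_le_sum_itemWeight (by omega) hsize hf
  have hupper : ∑ i, itemWeight size f (1 / ((t : ℝ) + 1)) i ≤
      n * (1 + halvingSum (1 / ((t : ℝ) + 1))) := by
    rw [← Finset.sum_fiberwise Finset.univ g]
    refine (Finset.sum_le_card_nsmul _ _ _ fun k _ => sum_itemWeight_le hpos hf (by positivity)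
      (one_div_le_one_div_of_le two_pos (by linarith)) _ (hg.2 k)).trans_eq ?_
    rw [Finset.card_univ, Fintype.card_fin, nsmul_eq_mul]
  have hseries : halvingSum (1 / ((t : ℝ) + 1)) =
      ∑' i : ℕ, 1 / (((t : ℝ) + 1) * 2 ^ (i + 1) - 1) := by
    refine tsum_congr fun i => ?_
    have h0 : (t : ℝ) + 1 ≠ 0 := by positivity
    rw [div_div, mul_sub, mul_one_div_cancel h0]
  rw [← hseries]
  linarith
end

section
/- Let t ≥ 2 be an integer and let I be a finite list of items, each with a real size in (0, 1/t]. Then every packing of I that is a (pure) Nash equilibrium uses at most ( (2t³ + t² + 2) / ((2t+1)(t² − t + 1)) )·OPT(I) + 5 bins, where OPT(I) is the minimum number of bins over all packings of I. -/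
/-- `f` is a (pure) Nash equilibrium packing: no item can move to another bin of
the packing in which it fits and whose resulting load would strictly exceed the
load of its current bin. -/
def IsNE {ι : Type*} [Fintype ι] (size : ι → ℝ) (m : ℕ) (f : ι → Fin m) : Prop :=
  IsPacking size m f ∧
    ∀ i : ι, ∀ k : Fin m, k ≠ f i → binLoad size f k + size i ≤ 1 →
      binLoad size f k + size i ≤ binLoad size f (f i)

/-- The weight of an item of size `a` packed in a bin of small load: it is affine in the size,
up to a cap. -/
noncomputable def cappedWeight (τ η K a : ℝ) : ℝ :=
  1 / τ + min (K * (a - 1 / (τ + 1)) - η / (τ + 1)) ((τ - 1) * η)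

lemma one_le_sum_cappedWeight {ι : Type*} (t : ℕ) (ht : 2 ≤ t) (size : ι → ℝ) (S : Finset ι)
    (hcard : S.card = t) {η K δ : ℝ} (hη : 0 ≤ η) (hK : 0 ≤ K)
    (hKη : K * δ * (t + 1) = t * η)
    (hlarge : ∀ i ∈ S, 1 / ((t : ℝ) + 1) - δ ≤ size i)
    (hsum : (t : ℝ) / (t + 1) + δ ≤ ∑ i ∈ S, size i) :
    1 ≤ ∑ i ∈ S, cappedWeight t η K (size i) := by
  classical
  have ht' : (2 : ℝ) ≤ t := by exact_mod_cast ht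
  have hKδ : K * δ = t * η / (t + 1) := by field_simp; linarith
  by_cases hcap : ∃ j ∈ S, ((t : ℝ) - 1) * η ≤ K * (size j - 1 / ((t : ℝ) + 1)) - η / (t + 1)
  · obtain ⟨j, hj, hjc⟩ := hcap
    have hw : ∀ i ∈ S.erase j, 1 / (t : ℝ) - η ≤ cappedWeight t η K (size i) := by
      intro i hi
      have h1 := hlarge i (Finset.mem_of_mem_erase hi)
      have h2 : K * (-δ) ≤ K * (size i - 1 / ((t : ℝ) + 1)) :=
        mul_le_mul_of_nonneg_left (by linarith) hK
      have h3 : t * η / ((t : ℝ) + 1) + η / (t + 1) = η := by field_simp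
      unfold cappedWeight
      have : -η ≤ min (K * (size i - 1 / ((t : ℝ) + 1)) - η / (t + 1)) (((t : ℝ) - 1) * η) :=
        le_min (by linarith) (by nlinarith)
      linarith
    have h4 := Finset.card_nsmul_le_sum _ _ _ hw
    rw [Finset.card_erase_of_mem hj, hcard, nsmul_eq_mul, Nat.cast_sub (by omega)] at h4
    rw [← Finset.add_sum_erase S _ hj]
    have h5 : cappedWeight t η K (size j) = 1 / (t : ℝ) + (t - 1) * η := by
      unfold cappedWeight
      rw [min_eq_right hjc]
    have h6 : (t : ℝ) * (1 / t) = 1 := by field_simp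
    push_cast at h4
    rw [h5]
    nlinarith
  · push Not at hcap
    have hw : ∀ i ∈ S, cappedWeight t η K (size i)
        = (1 / (t : ℝ) - K / (t + 1) - η / (t + 1)) + K * size i := by
      intro i hi
      unfold cappedWeight
      rw [min_eq_left (hcap i hi).le]
      ring
    rw [Finset.sum_congr rfl hw, Finset.sum_add_distrib, Finset.sum_const, hcard, nsmul_eq_mul,
      ← Finset.mul_sum]
    have h1 := mul_le_mul_of_nonneg_left hsum hK
    have h2 : (t : ℝ) * (1 / t - K / (t + 1) - η / (t + 1)) + K * (t / (t + 1) + δ) = 1 := by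
      rw [mul_add K, hKδ]
      field_simp
      ring
    linarith

lemma sum_cappedWeight_add_le {ι : Type*} (t : ℕ) (ht : 2 ≤ t) (size : ι → ℝ) (P : Finset ι)
    {η K δ c b : ℝ} (hη : 0 ≤ η) (hc : 0 ≤ c) (hcK : c ≤ K)
    (hct : c ≤ 1 + 1 / (t : ℝ))
    (hcη : c + ((t : ℝ) + 1) * (t * (t - 1)) * η = (1 / t - η) * (t + 1))
    (hδ : ((t : ℝ) + 2) * (t + 1) * δ < 1)
    (hlarge : ∀ i ∈ P, 1 / ((t : ℝ) + 1) - δ ≤ size i)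
    (hb : 0 ≤ b) (hsum : ∑ i ∈ P, size i + b ≤ 1) :
    ∑ i ∈ P, cappedWeight t η K (size i) + c * b ≤ 1 + 1 / (t : ℝ) - η := by
  have ht' : (2 : ℝ) ≤ t := by exact_mod_cast ht
  have hcard : P.card ≤ t + 1 := by
    by_contra! h
    have h1 := Finset.card_nsmul_le_sum _ _ _ hlarge
    rw [nsmul_eq_mul] at h1
    have h2 : ((t : ℝ) + 2) ≤ P.card := by exact_mod_cast h
    have h3 : ((t : ℝ) + 2) * δ < 1 / (t + 1) := by
      rw [lt_div_iff₀ (by positivity)]; linarith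
    have h4 : ((t : ℝ) + 2) * (1 / (t + 1)) = 1 + 1 / (t + 1) := by field_simp; ring
    have h5 : 0 ≤ 1 / ((t : ℝ) + 1) - δ := by
      by_contra! h
      nlinarith
    nlinarith
  rcases Nat.lt_or_ge t P.card with h | h
  · have hk : P.card = t + 1 := by omega
    have hw : ∀ i ∈ P, cappedWeight t η K (size i)
        ≤ (1 / (t : ℝ) - K / (t + 1) - η / (t + 1)) + K * size i := by
      intro i hi
      unfold cappedWeight
      have := min_le_left (K * (size i - 1 / ((t : ℝ) + 1)) - η / (t + 1)) (((t : ℝ) - 1) * η)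
      have h2 : K * (size i - 1 / ((t : ℝ) + 1)) = K * size i - K / (t + 1) := by ring
      linarith
    have h1 := Finset.sum_le_sum hw
    rw [Finset.sum_add_distrib, Finset.sum_const, hk, nsmul_eq_mul, ← Finset.mul_sum] at h1
    push_cast at h1
    have h2 : ((t : ℝ) + 1) * (1 / t - K / (t + 1) - η / (t + 1)) = 1 + 1 / t - K - η := by
      field_simp
    nlinarith
  · have hM : 0 ≤ 1 / (t : ℝ) + (t - 1) * η - c / (t + 1) := by
      have h1 : c / ((t : ℝ) + 1) ≤ 1 / t := by
        rw [div_le_iff₀ (by positivity)]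
        have : 1 / (t : ℝ) * (t + 1) = 1 + 1 / t := by field_simp
        linarith
      nlinarith
    have hw : ∀ i ∈ P, cappedWeight t η K (size i)
        ≤ (1 / (t : ℝ) + (t - 1) * η - c / (t + 1)) + c * size i := by
      intro i hi
      unfold cappedWeight
      have h1 := min_le_left (K * (size i - 1 / ((t : ℝ) + 1)) - η / (t + 1)) (((t : ℝ) - 1) * η)
      have h2 := min_le_right (K * (size i - 1 / ((t : ℝ) + 1)) - η / (t + 1)) (((t : ℝ) - 1) * η)
      have h3 : c * (size i - 1 / ((t : ℝ) + 1)) = c * size i - c / (t + 1) := by ring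
      rcases le_total 0 (size i - 1 / ((t : ℝ) + 1)) with h | h
      · nlinarith
      · have h4 : 0 ≤ η / ((t : ℝ) + 1) := by positivity
        nlinarith
    have h1 := Finset.sum_le_sum hw
    rw [Finset.sum_add_distrib, Finset.sum_const, nsmul_eq_mul, ← Finset.mul_sum] at h1
    have h2 : (P.card : ℝ) ≤ t := by exact_mod_cast h
    have h3 := mul_le_mul_of_nonneg_right h2 hM
    have h4 : (t : ℝ) * (1 / t + (t - 1) * η - c / (t + 1)) + c = 1 + 1 / t - η := by
      have hc' : c = (1 / t - η) * (t + 1) - ((t : ℝ) + 1) * (t * (t - 1)) * η := by linarith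
      rw [hc']
      field_simp
      ring
    nlinarith

section Equilibrium

variable {ι : Type*} [Fintype ι] {size : ι → ℝ} {m : ℕ} {f : ι → Fin m}

lemma sum_binLoad (size : ι → ℝ) (f : ι → Fin m) : ∑ k, binLoad size f k = ∑ i, size i :=
  Finset.sum_fiberwise _ _ _

lemma IsNE.one_lt_binLoad_add (hf : IsNE size m f) {i : ι} (hi : 0 < size i) {k : Fin m}
    (hk : k ≠ f i) (hle : binLoad size f (f i) ≤ binLoad size f k) :
    1 < binLoad size f k + size i := by
  by_contra! h
  linarith [hf.2 i k hk h]

lemma IsNE.not_three_low {t : ℕ} (ht : 2 ≤ t) (hf : IsNE size m f)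
    (hsize : ∀ i, size i ∈ Set.Ioc (0 : ℝ) (1 / (t : ℝ))) {x y z : Fin m}
    (hxy : x ≠ y) (hyz : y ≠ z) (hle : binLoad size f x ≤ binLoad size f y)
    (hle' : binLoad size f y ≤ binLoad size f z) :
    (t : ℝ) / (t + 1) < binLoad size f z := by
  have ht' : (2 : ℝ) ≤ t := by exact_mod_cast ht
  by_contra! hz
  have hitem : ∀ i ∈ Finset.univ.filter (fun i => f i = y), 1 / ((t : ℝ) + 1) < size i := by
    intro i hi
    have hi' : f i = y := by simpa using hi
    have h1 := hf.one_lt_binLoad_add (hsize i).1 (k := z) (by rw [hi']; exact hyz.symm)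
      (by rw [hi']; exact hle')
    have : (t : ℝ) / (t + 1) + 1 / (t + 1) = 1 := by field_simp
    linarith
  have hlow := Finset.card_nsmul_le_sum _ _ _ (fun i hi => (hitem i hi).le)
  have hupp := Finset.sum_le_card_nsmul (Finset.univ.filter (fun i => f i = y)) size _
    (fun i _ => (hsize i).2)
  obtain ⟨j, hj⟩ := hf.1.1 y
  have hne : (Finset.univ.filter (fun i => f i = y)).Nonempty := ⟨j, by simpa using hj⟩
  have hlow' := Finset.sum_lt_sum_of_nonempty hne hitem
  rw [Finset.sum_const] at hlow'
  rw [nsmul_eq_mul] at hupp hlow'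
  change _ < binLoad size f y at hlow'
  change binLoad size f y ≤ _ at hupp
  have hcard : t ≤ (Finset.univ.filter (fun i => f i = y)).card := by
    by_contra! hlt
    obtain ⟨i, hi⟩ := hf.1.1 x
    have h1 := hf.one_lt_binLoad_add (hsize i).1 (k := y) (by rw [hi]; exact hxy.symm)
      (by rw [hi]; exact hle)
    have h2 := (hsize i).2
    have h3 : (((Finset.univ.filter (fun i => f i = y)).card : ℝ) + 1) ≤ t := by exact_mod_cast hlt
    have h4 := mul_le_mul_of_nonneg_right h3 (show 0 ≤ 1 / (t : ℝ) by positivity)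
    have h5 : (t : ℝ) * (1 / t) = 1 := by field_simp
    linarith
  have h1 : (t : ℝ) ≤ (Finset.univ.filter (fun i => f i = y)).card := by exact_mod_cast hcard
  have h2 := mul_le_mul_of_nonneg_right h1 (show 0 ≤ 1 / ((t : ℝ) + 1) by positivity)
  have h3 : (t : ℝ) * (1 / (t + 1)) = t / (t + 1) := by ring
  linarith

lemma IsNE.card_low_le_two {t : ℕ} (ht : 2 ≤ t) (hf : IsNE size m f)
    (hsize : ∀ i, size i ∈ Set.Ioc (0 : ℝ) (1 / (t : ℝ))) :
    (Finset.univ.filter (fun k => binLoad size f k ≤ (t : ℝ) / (t + 1))).card ≤ 2 := by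
  by_contra! h
  obtain ⟨x, y, z, hx, hy, hz, hxy, hxz, hyz⟩ := Finset.two_lt_card_iff.1 h
  simp only [Finset.mem_filter, Finset.mem_univ, true_and] at hx hy hz
  have key : ∀ {x y z : Fin m}, x ≠ y → y ≠ z → binLoad size f x ≤ binLoad size f y →
      binLoad size f y ≤ binLoad size f z → binLoad size f z ≤ (t : ℝ) / (t + 1) → False :=
    fun h1 h2 h3 h4 h5 => absurd (hf.not_three_low ht hsize h1 h2 h3 h4) (not_lt.2 h5)
  rcases le_total (binLoad size f x) (binLoad size f y) with h1 | h1 <;>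
  rcases le_total (binLoad size f y) (binLoad size f z) with h2 | h2 <;>
  rcases le_total (binLoad size f x) (binLoad size f z) with h3 | h3
  · exact key hxy hyz h1 h2 hz
  · exact key hxy hyz h1 h2 hz
  · exact key hxz hyz.symm h3 h2 hy
  · exact key hxz.symm hxy h3 h1 hy
  · exact key hxy.symm hxz h1 h3 hz
  · exact key hyz hxz.symm h2 h3 hx
  · exact key hyz.symm hxy.symm h2 h1 hx
  · exact key hyz.symm hxy.symm h2 h1 hx

lemma IsNE.lt_size_of_medium {t : ℕ} (hf : IsNE size m f) (hpos : ∀ i, 0 < size i)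
    {p q : Fin m} (hp : (t : ℝ) / (t + 1) < binLoad size f p)
    (hq : binLoad size f q ≤ (2 * (t : ℝ) + 1) / (2 * (t + 1))) {i : ι} (hip : p ≠ f i)
    (hiq : q ≠ f i) (hle : binLoad size f (f i) ≤ binLoad size f q) :
    1 - binLoad size f p < size i := by
  have h1 := hf.one_lt_binLoad_add (hpos i) hiq hle
  by_contra! h
  have h2 := hf.2 i p hip (by linarith)
  have h3 : 1 - (2 * (t : ℝ) + 1) / (2 * (t + 1))
      = (2 * (t : ℝ) + 1) / (2 * (t + 1)) - t / (t + 1) := by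
    field_simp
    ring
  linarith

lemma card_filter_eq_of_medium {t : ℕ} (ht : 2 ≤ t)
    (hle : ∀ i, size i ≤ 1 / (t : ℝ)) {k : Fin m} {δ : ℝ}
    (hδ : 2 * ((t : ℝ) + 1) ^ 2 * δ < 1)
    (hlarge : ∀ i, f i = k → 1 / ((t : ℝ) + 1) - δ ≤ size i)
    (hlow : (t : ℝ) / (t + 1) < binLoad size f k)
    (hupp : binLoad size f k ≤ (2 * (t : ℝ) + 1) / (2 * (t + 1))) :
    (Finset.univ.filter (fun i => f i = k)).card = t := by
  have ht' : (2 : ℝ) ≤ t := by exact_mod_cast ht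
  have h1 := Finset.card_nsmul_le_sum (Finset.univ.filter (fun i => f i = k)) size _
    (fun i hi => hlarge i (by simpa using hi))
  have h2 := Finset.sum_le_card_nsmul (Finset.univ.filter (fun i => f i = k)) size _
    (fun i _ => hle i)
  rw [nsmul_eq_mul] at h1 h2
  change _ ≤ binLoad size f k at h1
  change binLoad size f k ≤ _ at h2
  apply le_antisymm
  · by_contra! h
    have h3 : (t : ℝ) + 1 ≤ (Finset.univ.filter (fun i => f i = k)).card := by exact_mod_cast h
    have h4 : 0 ≤ 1 / ((t : ℝ) + 1) - δ := by
      rw [sub_nonneg, le_div_iff₀ (by positivity)]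
      nlinarith
    have h5 := mul_le_mul_of_nonneg_right h3 h4
    have h6 : ((t : ℝ) + 1) * (1 / (t + 1) - δ) = 1 - (t + 1) * δ := by field_simp
    have h7 : ((t : ℝ) + 1) * δ < 1 / (2 * (t + 1)) := by
      rw [lt_div_iff₀ (by positivity)]
      linarith
    have h8 : (2 * (t : ℝ) + 1) / (2 * (t + 1)) + 1 / (2 * (t + 1)) = 1 := by
      field_simp
      ring
    linarith
  · by_contra! h
    have h3 : ((Finset.univ.filter (fun i => f i = k)).card : ℝ) + 1 ≤ t := by exact_mod_cast h
    have h4 := mul_le_mul_of_nonneg_right h3 (show 0 ≤ 1 / (t : ℝ) by positivity)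
    have h5 : (t : ℝ) * (1 / t) = 1 := by field_simp
    have h6 : 1 / ((t : ℝ) + 1) ≤ 1 / t := one_div_le_one_div_of_le (by positivity) (by linarith)
    have h7 : (t : ℝ) / (t + 1) + 1 / (t + 1) = 1 := by field_simp
    linarith

end Equilibrium

set_option maxHeartbeats 1000000 in
/-- Upper bound on the Price of Anarchy of the parametric bin packing game:
for item sizes in `(0, 1/t]` with `t ≥ 2`, every Nash equilibrium packing uses at
most `((2t³ + t² + 2)/((2t+1)(t² - t + 1)))·OPT + 5` bins (stated against an
arbitrary packing `g` into `n ≥ OPT` bins). -/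
theorem nePacking_le (t : ℕ) (ht : 2 ≤ t) {ι : Type*} [Fintype ι]
    (size : ι → ℝ) (hsize : ∀ i, size i ∈ Set.Ioc (0 : ℝ) (1 / (t : ℝ))) {m n : ℕ}
    (f : ι → Fin m) (g : ι → Fin n)
    (hf : IsNE size m f) (hg : IsPacking size n g) :
    (m : ℝ) ≤ ((2 * (t : ℝ) ^ 3 + (t : ℝ) ^ 2 + 2)
        / ((2 * (t : ℝ) + 1) * ((t : ℝ) ^ 2 - (t : ℝ) + 1))) * n + 5 := by
  classical
  have ht' : (2 : ℝ) ≤ t := by exact_mod_cast ht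
  set N : ℝ := 2 * (t : ℝ) ^ 3 + (t : ℝ) ^ 2 + 2 with hN
  set D : ℝ := (2 * (t : ℝ) + 1) * ((t : ℝ) ^ 2 - (t : ℝ) + 1) with hD
  have hNpos : 0 < N := by positivity
  have hDpos : 0 < D := mul_pos (by positivity) (by nlinarith)
  have hpos : ∀ i, 0 < size i := fun i => (hsize i).1
  have hnonneg : ∀ k, 0 ≤ binLoad size f k := fun k => Finset.sum_nonneg fun i _ => (hpos i).le
  have htotal : ∑ i, size i ≤ n := by
    rw [← sum_binLoad size g]
    simpa using Finset.sum_le_card_nsmul Finset.univ (binLoad size g) 1 (fun k _ => hg.2 k)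
  set low := Finset.univ.filter (fun k => binLoad size f k ≤ (t : ℝ) / (t + 1)) with hlow
  have hlow2 : low.card ≤ 2 := hf.card_low_le_two ht hsize
  have hcompl : m = low.card + lowᶜ.card := by simp [Finset.card_add_card_compl]
  by_cases hall : ∀ k ∈ lowᶜ, D / N ≤ binLoad size f k
  · have h1 := Finset.card_nsmul_le_sum _ _ _ hall
    have h2 : ∑ k ∈ lowᶜ, binLoad size f k ≤ ∑ k, binLoad size f k :=
      Finset.sum_le_sum_of_subset_of_nonneg (Finset.subset_univ _) (fun k _ _ => hnonneg k)
    rw [nsmul_eq_mul] at h1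
    rw [sum_binLoad] at h2
    have h3 : (lowᶜ.card : ℝ) ≤ N / D * n := by
      have h4 : (lowᶜ.card : ℝ) * (D / N) ≤ n := by linarith
      calc (lowᶜ.card : ℝ) = N / D * (lowᶜ.card * (D / N)) := by field_simp
        _ ≤ N / D * n := mul_le_mul_of_nonneg_left h4 (by positivity)
    have h5 : (low.card : ℝ) ≤ 2 := by exact_mod_cast hlow2
    have h6 : (m : ℝ) = low.card + lowᶜ.card := by exact_mod_cast hcompl
    linarith
  push Not at hall
  obtain ⟨p₀, hp₀, hp₀'⟩ := hall
  obtain ⟨p, hp, hpmin⟩ := Finset.exists_min_image lowᶜ (binLoad size f) ⟨p₀, hp₀⟩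
  have hpD : binLoad size f p < D / N := (hpmin p₀ hp₀).trans_lt hp₀'
  have hpt : (t : ℝ) / (t + 1) < binLoad size f p := by simpa [hlow] using hp
  obtain ⟨δ, hδ⟩ : ∃ δ, δ = binLoad size f p - (t : ℝ) / (t + 1) := ⟨_, rfl⟩
  have hδpos : 0 < δ := by linarith
  have hδN : ((t : ℝ) + 1) * N * δ < 1 := by
    have h1 : binLoad size f p * N < D := by rwa [lt_div_iff₀ hNpos] at hpD
    have h2 : ((t : ℝ) + 1) * N * δ = (t + 1) * (binLoad size f p * N) - t * N := by
      rw [hδ]; field_simp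
    have h3 : ((t : ℝ) + 1) * D - t * N = 1 := by rw [hN, hD]; ring
    nlinarith
  set T : ℝ := (2 * (t : ℝ) + 1) / (2 * (t + 1)) with hT
  have hTpos : 0 < T := by positivity
  have hDT : D / N ≤ T := by
    rw [hT, div_le_div_iff₀ hNpos (by positivity), hN, hD]
    have : (0 : ℝ) ≤ (2 * t + 1) * (2 * t ^ 3 + t ^ 2 - 2 * t ^ 3) := by
      ring_nf; positivity
    nlinarith
  set med := Finset.univ.filter (fun k => binLoad size f k ≤ T) with hmed
  obtain ⟨q, hq, hqmax⟩ := Finset.exists_max_image med (binLoad size f)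
    ⟨p, by simpa [hmed] using hpD.le.trans hDT⟩
  have hqT : binLoad size f q ≤ T := by simpa [hmed] using hq
  set A := ((med \ low).erase p).erase q with hA
  have hAmem : ∀ k, k ∈ A → k ≠ q ∧ k ≠ p ∧ binLoad size f k ≤ T ∧
      (t : ℝ) / (t + 1) < binLoad size f k := by
    intro k hk
    simpa [hA, hmed, hlow] using hk
  have hlarge : ∀ i, f i ∈ A → 1 / ((t : ℝ) + 1) - δ ≤ size i := by
    intro i hi
    obtain ⟨h1, h2, h3, h4⟩ := hAmem _ hi
    have h5 := hf.lt_size_of_medium hpos hpt hqT h2.symm h1.symm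
      (hqmax _ (by simpa [hmed] using h3))
    have h6 : (t : ℝ) / (t + 1) + 1 / (t + 1) = 1 := by field_simp
    linarith
  have hδ1 : ((t : ℝ) + 2) * (t + 1) * δ < 1 := by
    have : ((t : ℝ) + 2) * ((t + 1) * δ) ≤ N * ((t + 1) * δ) :=
      mul_le_mul_of_nonneg_right (by rw [hN]; nlinarith [pow_nonneg (by linarith : (0 : ℝ) ≤ t) 3])
        (by positivity)
    linarith
  have hδ2 : 2 * ((t : ℝ) + 1) ^ 2 * δ < 1 := by
    have : (2 * ((t : ℝ) + 1)) * ((t + 1) * δ) ≤ N * ((t + 1) * δ) :=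
      mul_le_mul_of_nonneg_right
        (by rw [hN]; nlinarith [mul_nonneg (by linarith : (0 : ℝ) ≤ t) (sq_nonneg ((t : ℝ) - 1))])
        (by positivity)
    nlinarith
  set η : ℝ := 1 / (t * D) with hη
  have hηpos : 0 < η := by positivity
  set K : ℝ := 1 / (D * δ * (t + 1)) with hK
  have hKpos : 0 < K := by positivity
  have hKη : K * δ * (t + 1) = t * η := by rw [hK, hη]; field_simp
  have hR : N / D = 1 + 1 / (t : ℝ) - η := by
    rw [hη]
    field_simp
    rw [hN, hD]
    ring
  have hc : 1 / T = 2 * ((t : ℝ) + 1) / (2 * t + 1) := by rw [hT, one_div_div]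
  have hcK : 1 / T ≤ K := by
    have h1 : 1 / T ≤ N / D := by
      rw [← one_div_div D N]
      exact one_div_le_one_div_of_le (by positivity) hDT
    have h2 : N / D ≤ K := by
      rw [hK, div_le_div_iff₀ hDpos (by positivity)]
      nlinarith
    exact h1.trans h2
  have hct : 1 / T ≤ 1 + 1 / (t : ℝ) := by
    rw [hc, div_le_iff₀ (by positivity)]
    field_simp
    nlinarith
  have hcη : 1 / T + ((t : ℝ) + 1) * (t * (t - 1)) * η = (1 / t - η) * (t + 1) := by
    obtain ⟨E, hE⟩ : ∃ E, E = (t : ℝ) ^ 2 - t + 1 := ⟨_, rfl⟩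
    have hE0 : E ≠ 0 := by rw [hE]; nlinarith
    rw [hc, hη, hD, ← hE]
    field_simp
    rw [hE]
    ring
  let W : ι → ℝ := fun i => if f i ∈ A then cappedWeight t η K (size i) else 1 / T * size i
  have hupper : ∑ i, W i ≤ N / D * n := by
    rw [← Finset.sum_fiberwise Finset.univ g W]
    have hbin : ∀ k ∈ Finset.univ, ∑ i ∈ Finset.univ.filter (fun i => g i = k), W i ≤ N / D := by
      intro k _
      rw [Finset.sum_ite, ← Finset.mul_sum, hR]
      refine sum_cappedWeight_add_le t ht size _ hηpos.le (by positivity) hcK hct hcη hδ1 ?_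
        (Finset.sum_nonneg fun i _ => (hpos i).le) ?_
      · intro i hi
        exact hlarge i (Finset.mem_filter.1 hi).2
      · rw [Finset.sum_filter_add_sum_filter_not]
        exact hg.2 k
    have := Finset.sum_le_card_nsmul _ _ _ hbin
    rw [Finset.card_univ, Fintype.card_fin, nsmul_eq_mul] at this
    linarith
  have hbinA : ∀ k ∈ A, 1 ≤ ∑ i ∈ Finset.univ.filter (fun i => f i = k), W i := by
    intro k hk
    obtain ⟨h1, h2, h3, h4⟩ := hAmem k hk
    have hlk : ∀ i, f i = k → 1 / ((t : ℝ) + 1) - δ ≤ size i := fun i hi =>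
      hlarge i (hi ▸ hk)
    have hW : ∀ i ∈ Finset.univ.filter (fun i => f i = k),
        W i = cappedWeight t η K (size i) := by
      intro i hi
      have hik : f i = k := by simpa using hi
      simp [W, hik, hk]
    rw [Finset.sum_congr rfl hW]
    refine one_le_sum_cappedWeight t ht size _
      (card_filter_eq_of_medium ht (fun i => (hsize i).2) hδ2 hlk h4 h3) hηpos.le hKpos.le hKη
      (fun i hi => hlk i (by simpa using hi)) ?_
    have := hpmin k (by simpa [hlow] using h4)
    change _ ≤ binLoad size f k
    linarith
  have hbinW : ∀ k ∉ A, ∑ i ∈ Finset.univ.filter (fun i => f i = k), W i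
      = 1 / T * binLoad size f k := by
    intro k hk
    rw [binLoad, Finset.mul_sum]
    refine Finset.sum_congr rfl fun i hi => ?_
    have hik : f i = k := by simpa using hi
    simp [W, hik, hk]
  have hbin : ∀ k ∈ A ∪ medᶜ, 1 ≤ ∑ i ∈ Finset.univ.filter (fun i => f i = k), W i := by
    intro k hk
    by_cases hkA : k ∈ A
    · exact hbinA k hkA
    · have h1 : T < binLoad size f k := by simpa [hkA, hmed] using hk
      rw [hbinW k hkA, one_div_mul_eq_div, one_le_div hTpos]
      exact h1.le
  have hlower : ((A ∪ medᶜ).card : ℝ) ≤ ∑ i, W i := by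
    rw [← Finset.sum_fiberwise Finset.univ f W]
    calc ((A ∪ medᶜ).card : ℝ)
        ≤ ∑ k ∈ A ∪ medᶜ, ∑ i ∈ Finset.univ.filter (fun i => f i = k), W i := by
          simpa using Finset.card_nsmul_le_sum _ _ _ hbin
      _ ≤ _ := by
          refine Finset.sum_le_sum_of_subset_of_nonneg (Finset.subset_univ _) fun k _ hk => ?_
          rw [hbinW k (fun h => hk (Finset.mem_union_left _ h))]
          exact mul_nonneg (by positivity) (hnonneg k)
  have hcover : (Finset.univ : Finset (Fin m)) ⊆ (A ∪ medᶜ) ∪ (low ∪ {p, q}) := by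
    intro k _
    simp only [hA, Finset.mem_union, Finset.mem_erase, Finset.mem_sdiff, Finset.mem_compl,
      Finset.mem_insert, Finset.mem_singleton]
    tauto
  have hcard : m ≤ (A ∪ medᶜ).card + 4 := by
    have h1 := Finset.card_le_card hcover
    have h2 := Finset.card_union_le (A ∪ medᶜ) (low ∪ {p, q})
    have h3 := Finset.card_union_le low {p, q}
    have h4 := Finset.card_le_two (a := p) (b := q)
    rw [Finset.card_univ, Fintype.card_fin] at h1
    omega
  have hcard' : (m : ℝ) ≤ (A ∪ medᶜ).card + 4 := by exact_mod_cast hcard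
  linarith
end
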